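/- Let a be an integer with gcd(a,m) = 1 and let C be a q-ary GQC code of block lengths (m_1,...,m_l) whose every constituent satisfies C_i = {0} or C_i = V_i. Let T = {i ∈ Z_m : C_i = {0}} and S = Z_m \ T. Then the following are equivalent: (1) C is μ_a-LCD; (2) S = −aS, where −aS = {−as mod m : s ∈ S}; (3) T = −aT; (4) μ_{−a}(C) = C. -/

import Mathlib

open scoped BigOperators

/-- The Euclidean dual of a linear code inside `∏ j, F[x]/(x^(m j) - 1)`, where each
quotient `F[x]/(x^(m j) - 1)` is identified with `F^(m j)` (coordinates indexed by
`ZMod (m j)`) via coefficient vectors. -/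
def gqcDual {F : Type*} [Field F] {l : ℕ} {m : Fin l → ℕ} [∀ j, NeZero (m j)]
    (C : Submodule F (∀ j, ZMod (m j) → F)) : Submodule F (∀ j, ZMod (m j) → F) where
  carrier := {b | ∀ c ∈ C, ∑ j, ∑ i, b j i * c j i = 0}
  zero_mem' := by intro c hc; simp
  add_mem' := by
    intro x y hx hy c hc
    simp only [Set.mem_setOf_eq, Pi.add_apply, add_mul, Finset.sum_add_distrib,
      hx c hc, hy c hc, add_zero]
  smul_mem' := by
    intro r x hx c hc
    simp only [Set.mem_setOf_eq, Pi.smul_apply, smul_eq_mul, mul_assoc,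
      ← Finset.mul_sum, hx c hc, mul_zero]

/-- A generalized quasi-cyclic (GQC) code of block lengths `(m 0, …, m (l-1))`:
an `F`-subspace of `∏ j, F[x]/(x^(m j) - 1)` (in coefficient-vector form) which is
closed under the simultaneous cyclic shift of all blocks, i.e. an `F[x]`-submodule. -/
def IsGQC {F : Type*} [Field F] {l : ℕ} {m : Fin l → ℕ}
    (C : Submodule F (∀ j, ZMod (m j) → F)) : Prop :=
  ∀ c ∈ C, (fun j i => c j (i - 1)) ∈ C

/-- The coordinate permutation `μ_a`, sending `(c_1(x), …, c_l(x))` to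
`(c_1(x^a) mod (x^(m 0) - 1), …, c_l(x^a) mod (x^(m (l-1)) - 1))`; on coefficient
vectors the coefficient of `x^i` of the image of `c_j` is the coefficient of
`x^(a⁻¹ i)` of `c_j` (inverse taken in `ZMod (m j)`). -/
def muMap {F : Type*} [Field F] {l : ℕ} (m : Fin l → ℕ) (a : ℤ) :
    (∀ j, ZMod (m j) → F) →ₗ[F] (∀ j, ZMod (m j) → F) where
  toFun c := fun j i => c j (((a : ZMod (m j)))⁻¹ * i)
  map_add' := fun _ _ => rfl
  map_smul' := fun _ _ => rfl

open Classical in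
/-- The `i`-th constituent `C_i` of a GQC code `C`:
`C_i = {(δ_{1,i} c_1(ξ^i), …, δ_{l,i} c_l(ξ^i)) : c ∈ C}`, where `δ_{j,i} = 1` iff
`ξ^(i * m j) = 1`, and `c_j(ξ^i) = ∑ t, c_j,t ξ^(i t)`. -/
noncomputable def constituent {F : Type*} [Field F] {l : ℕ} {m : Fin l → ℕ}
    [∀ j, NeZero (m j)] {K : Type*} [Field K] [Algebra F K] (ξ : K)
    (C : Submodule F (∀ j, ZMod (m j) → F)) (i : ℕ) : Set (Fin l → K) :=
  {v | ∃ c ∈ C, ∀ j, v j =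
      if ξ ^ (i * m j) = 1 then ∑ t : ZMod (m j), algebraMap F K (c j t) * ξ ^ (i * t.val)
      else 0}

/-- The space `V_i = {(y_1, …, y_l) ∈ F_q(ξ^i)^l : y_j = 0 whenever ξ^(i m_j) ≠ 1}`. -/
def Vset {l : ℕ} (m : Fin l → ℕ) (F : Type*) [Field F] {K : Type*} [Field K] [Algebra F K]
    (ξ : K) (i : ℕ) : Set (Fin l → K) :=
  {v | (∀ j, v j ∈ Algebra.adjoin F {ξ ^ i}) ∧ ∀ j, ξ ^ (i * m j) ≠ 1 → v j = 0}

/-- The Euclidean `V_i`-dual of a subset `S ⊆ V_i`: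
`S^{⊥'} = {w ∈ V_i : ∑ j, v j * w j = 0 for all v ∈ S}`. -/
def cDual {l : ℕ} (m : Fin l → ℕ) (F : Type*) [Field F] {K : Type*} [Field K] [Algebra F K]
    (ξ : K) (S : Set (Fin l → K)) (i : ℕ) : Set (Fin l → K) :=
  {w ∈ Vset m F ξ i | ∀ v ∈ S, ∑ j, v j * w j = 0}

section RootsOfUnity

variable {K : Type*} [Field K]

lemma zpow_eq_zpow_of_modEq {z : K} {n : ℕ} (hz : z ^ n = 1) {k k' : ℤ}
    (h : k ≡ k' [ZMOD n]) (hz0 : z ≠ 0) : z ^ k = z ^ k' := by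
  obtain ⟨c, hc⟩ := h.dvd
  rw [show k' = k + n * c by linarith, zpow_add₀ hz0, zpow_mul, zpow_natCast, hz, one_zpow,
    mul_one]

lemma ne_zero_of_pow_eq_one {z : K} {n : ℕ} [NeZero n] (hz : z ^ n = 1) : z ≠ 0 := by
  rintro rfl
  simp [NeZero.ne n] at hz

lemma pow_val_eq_zpow {z : K} {n : ℕ} [NeZero n] (hz : z ^ n = 1) {t : ZMod n} {k : ℤ}
    (h : (k : ZMod n) = t) : z ^ t.val = z ^ k := by
  rw [← zpow_natCast]
  refine zpow_eq_zpow_of_modEq hz ?_ (ne_zero_of_pow_eq_one hz)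
  rw [← ZMod.intCast_eq_intCast_iff, h]
  simp

lemma zpow_pow_eq_one_iff {z : K} {m n : ℕ} (hz : z ^ m = 1) (hz0 : z ≠ 0) {a : ℤ}
    (ha : IsCoprime a m) : (z ^ a) ^ n = 1 ↔ z ^ n = 1 := by
  have hcomm : (z ^ a) ^ n = (z ^ n) ^ a := by
    rw [← zpow_natCast, ← zpow_mul, mul_comm, zpow_mul, zpow_natCast]
  rw [hcomm]
  refine ⟨fun h => ?_, fun h => by rw [h, one_zpow]⟩
  obtain ⟨u, v, huv⟩ := ha
  have hzn : (z ^ n) ^ m = 1 := by rw [← pow_mul, mul_comm, pow_mul, hz, one_pow]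
  calc z ^ n = (z ^ n) ^ (a * u + m * v) := by
        rw [show a * u + m * v = 1 by linarith, zpow_one]
    _ = 1 := by
        rw [zpow_add₀ (pow_ne_zero n hz0), zpow_mul, zpow_mul, h, zpow_natCast, hzn]
        simp

lemma sum_nthRootsFinset_pow_val_mul {n : ℕ} [NeZero n] {η : K} (hη : IsPrimitiveRoot η n)
    (t u : ZMod n) :
    ∑ z ∈ Polynomial.nthRootsFinset n (1 : K), z ^ t.val * z⁻¹ ^ u.val =
      if t = u then (n : K) else 0 := by
  have hn : 0 < n := NeZero.pos n
  have hmem {z : K} : z ∈ Polynomial.nthRootsFinset n (1 : K) ↔ z ^ n = 1 :=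
    Polynomial.mem_nthRootsFinset hn 1
  have hη0 := ne_zero_of_pow_eq_one hη.pow_eq_one
  split_ifs with h
  · subst h
    rw [Finset.sum_congr rfl (g := fun _ => (1 : K)), Finset.sum_const, hη.card_nthRootsFinset,
      nsmul_one]
    intro z hz
    rw [← mul_pow, mul_inv_cancel₀ (ne_zero_of_pow_eq_one (hmem.1 hz)), one_pow]
  · set w := ∑ z ∈ Polynomial.nthRootsFinset n (1 : K), z ^ t.val * z⁻¹ ^ u.val with hw
    have hshift : η ^ t.val * η⁻¹ ^ u.val * w = w := by
      rw [hw, Finset.mul_sum]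
      refine Finset.sum_nbij' (fun z => η * z) (fun z => η⁻¹ * z) ?_ ?_ ?_ ?_ ?_
      · intro z hz
        rw [hmem] at hz ⊢
        rw [mul_pow, hz, hη.pow_eq_one, one_mul]
      · intro z hz
        rw [hmem] at hz ⊢
        rw [mul_pow, hz, inv_pow, hη.pow_eq_one, inv_one, one_mul]
      · intro z _
        exact inv_mul_cancel_left₀ hη0 z
      · intro z _
        exact mul_inv_cancel_left₀ hη0 z
      · intro z _
        rw [mul_inv, mul_pow, mul_pow]
        ring
    have hne : η ^ t.val * η⁻¹ ^ u.val ≠ 1 := by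
      intro heq
      rw [inv_pow, mul_inv_eq_one₀ (pow_ne_zero _ hη0)] at heq
      exact h (ZMod.val_injective n (hη.pow_inj t.val_lt u.val_lt heq))
    by_contra h0
    exact hne (mul_right_cancel₀ h0 (hshift.trans (one_mul _).symm))

lemma eq_zero_of_forall_sum_pow_mul_eq_zero {A : Finset K} {g : K → K}
    (h : ∀ s : ℕ, ∑ z ∈ A, z ^ s * g z = 0) {z : K} (hz : z ∈ A) : g z = 0 := by
  classical
  have hpoly (p : Polynomial K) : ∑ z ∈ A, p.eval z * g z = 0 := by
    simp only [Polynomial.eval_eq_sum_range, Finset.sum_mul, mul_assoc]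
    rw [Finset.sum_comm]
    simp [← Finset.mul_sum, h]
  have hbasis := hpoly (Lagrange.basis A id z)
  rw [Finset.sum_eq_single_of_mem z hz] at hbasis
  · have := Lagrange.eval_basis_self (v := id) Function.injective_id.injOn hz
    simp only [id_eq] at this
    simpa [this] using hbasis
  · intro y hy hyz
    have := Lagrange.eval_basis_of_ne (v := id) hyz.symm hy
    simp only [id_eq] at this
    rw [this, zero_mul]

end RootsOfUnity

lemma isUnit_intCast_zmod {a : ℤ} {n : ℕ} (ha : IsCoprime a (n : ℤ)) : IsUnit (a : ZMod n) :=
  (ZMod.unitOfIsCoprime a ha).isUnit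

section Code

variable {F : Type*} [Field F] {l : ℕ} {m : Fin l → ℕ}

lemma muMap_bijective {a : ℤ} (ha : ∀ j, IsCoprime a (m j : ℤ)) [∀ j, NeZero (m j)] :
    Function.Bijective (muMap (F := F) m a) := by
  have hinj : Function.Injective (muMap (F := F) m a) := by
    intro c d hcd
    funext j t
    have := congrFun (congrFun hcd j) ((a : ZMod (m j)) * t)
    simpa only [muMap, LinearMap.coe_mk, AddHom.coe_mk, ← mul_assoc,
      ZMod.coe_int_inv_mul_eq_one (ha j), one_mul] using this
  exact ⟨hinj, LinearMap.injective_iff_surjective.1 hinj⟩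

variable [∀ j, NeZero (m j)]

lemma sum_muMap_mul_muMap {a : ℤ} (ha : ∀ j, IsCoprime a (m j : ℤ))
    (c d : ∀ j, ZMod (m j) → F) :
    ∑ j, ∑ t, muMap m a c j t * muMap m a d j t = ∑ j, ∑ t, c j t * d j t := by
  refine Finset.sum_congr rfl fun j _ => ?_
  have hu : IsUnit ((a : ZMod (m j))⁻¹) := ZMod.isUnit_inv (isUnit_intCast_zmod (ha j))
  exact Fintype.sum_equiv (Units.mulLeft hu.unit) _ _ fun t => rfl

/-- The Euclidean inner product on `∏ j, F^(m j)`. -/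
def gqcForm (F : Type*) [Field F] {l : ℕ} (m : Fin l → ℕ) [∀ j, NeZero (m j)] :
    LinearMap.BilinForm F (∀ j, ZMod (m j) → F) :=
  LinearMap.mk₂ F (fun c d => ∑ j, ∑ t, d j t * c j t)
    (by intros; simp [mul_add, Finset.sum_add_distrib])
    (by intros; simp [Finset.mul_sum, mul_left_comm])
    (by intros; simp [add_mul, Finset.sum_add_distrib])
    (by intros; simp [Finset.mul_sum, mul_assoc])

lemma gqcForm_apply (c d : ∀ j, ZMod (m j) → F) :
    gqcForm F m c d = ∑ j, ∑ t, d j t * c j t := rfl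

lemma gqcForm_comm (c d : ∀ j, ZMod (m j) → F) : gqcForm F m c d = gqcForm F m d c := by
  simp only [gqcForm_apply, mul_comm]

lemma gqcForm_isRefl : (gqcForm F m).IsRefl := fun c d h => by rwa [gqcForm_comm]

lemma gqcForm_nondegenerate : (gqcForm F m).Nondegenerate := by
  refine (LinearMap.IsRefl.nondegenerate_iff_separatingLeft (B := gqcForm F m)
    fun c d => gqcForm_isRefl c d).2 ?_
  intro c hc
  funext j t
  classical
  have := hc (Pi.single j (Pi.single t 1))
  rw [gqcForm_apply, Finset.sum_eq_single j, Finset.sum_eq_single t] at this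
  · simpa using this
  · intro u _ hu
    simp [hu]
  · simp
  · intro i _ hi
    simp [hi]
  · simp

lemma gqcDual_eq_orthogonal (C : Submodule F (∀ j, ZMod (m j) → F)) :
    gqcDual C = (gqcForm F m).orthogonal C := rfl

lemma gqcDual_gqcDual (C : Submodule F (∀ j, ZMod (m j) → F)) : gqcDual (gqcDual C) = C := by
  simp only [gqcDual_eq_orthogonal]
  exact LinearMap.BilinForm.orthogonal_orthogonal gqcForm_nondegenerate gqcForm_isRefl C

lemma sup_gqcDual_eq_top {C D : Submodule F (∀ j, ZMod (m j) → F)}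
    (hdim : Module.finrank F D = Module.finrank F C) (h : C ⊓ gqcDual D = ⊥) :
    C ⊔ gqcDual D = ⊤ := by
  apply Submodule.eq_top_of_finrank_eq
  have h1 := Submodule.finrank_sup_add_finrank_inf_eq C (gqcDual D)
  have h2 := LinearMap.BilinForm.finrank_orthogonal (gqcForm_nondegenerate (F := F) (m := m)) D
  have h3 := Submodule.finrank_le D
  rw [h, finrank_bot, gqcDual_eq_orthogonal] at h1
  rw [gqcDual_eq_orthogonal]
  omega

section Evaluation

variable {K : Type*} [Field K] [Algebra F K]

open Classical in
/-- The evaluation `c ↦ (δ_j c_j(z))_j`, where `δ_j = 1` if `z ^ (m j) = 1` and `δ_j = 0`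
otherwise. -/
noncomputable def evalAt (F : Type*) [Field F] {l : ℕ} (m : Fin l → ℕ) [∀ j, NeZero (m j)]
    {K : Type*} [Field K] [Algebra F K] (z : K) :
    (∀ j, ZMod (m j) → F) →ₗ[F] (Fin l → K) where
  toFun c j := if z ^ m j = 1 then ∑ t, algebraMap F K (c j t) * z ^ t.val else 0
  map_add' c d := by
    funext j
    by_cases h : z ^ m j = 1 <;> simp [h, add_mul, Finset.sum_add_distrib]
  map_smul' r c := by
    funext j
    by_cases h : z ^ m j = 1 <;> simp [h, Algebra.smul_def, Finset.mul_sum, mul_assoc]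

lemma evalAt_apply_of_pow_eq_one {z : K} {j : Fin l} (hz : z ^ m j = 1)
    (c : ∀ j, ZMod (m j) → F) :
    evalAt F m z c j = ∑ t, algebraMap F K (c j t) * z ^ t.val := if_pos hz

lemma evalAt_apply_of_pow_ne_one {z : K} {j : Fin l} (hz : z ^ m j ≠ 1)
    (c : ∀ j, ZMod (m j) → F) : evalAt F m z c j = 0 := if_neg hz

lemma constituent_eq_range_evalAt (ξ : K) (C : Submodule F (∀ j, ZMod (m j) → F)) (i : ℕ) :
    constituent ξ C i = evalAt F m (ξ ^ i) '' C := by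
  have hite (p : Prop) {_ : Decidable p} (c : ∀ j, ZMod (m j) → F) (j : Fin l)
      (hp : p ↔ (ξ ^ i) ^ m j = 1) :
      (if p then ∑ t, algebraMap F K (c j t) * ξ ^ (i * t.val) else 0) =
        evalAt F m (ξ ^ i) c j := by
    by_cases hz : (ξ ^ i) ^ m j = 1
    · simp only [evalAt_apply_of_pow_eq_one hz, if_pos (hp.2 hz), pow_mul]
    · rw [evalAt_apply_of_pow_ne_one hz, if_neg (mt hp.1 hz)]
  ext v
  constructor
  · rintro ⟨c, hc, h⟩
    exact ⟨c, hc, funext fun j => ((h j).trans (hite _ c j (by rw [pow_mul]))).symm⟩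
  · rintro ⟨c, hc, rfl⟩
    exact ⟨c, hc, fun j => (hite _ c j (by rw [pow_mul])).symm⟩

lemma evalAt_shift (z : K) (c : ∀ j, ZMod (m j) → F) :
    evalAt F m z (fun j t => c j (t - 1)) = z • evalAt F m z c := by
  funext j
  by_cases hz : z ^ m j = 1
  · have hz0 := ne_zero_of_pow_eq_one hz
    rw [Pi.smul_apply, evalAt_apply_of_pow_eq_one hz, evalAt_apply_of_pow_eq_one hz, smul_eq_mul,
      Finset.mul_sum]
    refine Fintype.sum_equiv (Equiv.subRight 1) _ _ fun t => ?_
    have hpow : z ^ t.val = z * z ^ (t - 1).val := by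
      rw [pow_val_eq_zpow hz (k := (t - 1).val + 1) (by simp), zpow_add₀ hz0, zpow_natCast,
        zpow_one, mul_comm]
    simp only [Equiv.subRight_apply, hpow]
    ring
  · simp [evalAt_apply_of_pow_ne_one hz]

lemma evalAt_muMap {z : K} {n : ℕ} [NeZero n] (hz : z ^ n = 1) {a : ℤ} (ha : IsCoprime a n)
    (hdvd : ∀ j, m j ∣ n) (c : ∀ j, ZMod (m j) → F) :
    evalAt F m z (muMap m a c) = evalAt F m (z ^ a) c := by
  funext j
  have hiff := zpow_pow_eq_one_iff (n := m j) hz (ne_zero_of_pow_eq_one hz) ha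
  by_cases hzj : z ^ m j = 1
  · rw [evalAt_apply_of_pow_eq_one hzj, evalAt_apply_of_pow_eq_one (hiff.2 hzj)]
    have haj : IsCoprime a (m j : ℤ) :=
      ha.of_isCoprime_of_dvd_right (Int.natCast_dvd_natCast.2 (hdvd j))
    have hu : IsUnit ((a : ZMod (m j))⁻¹) := ZMod.isUnit_inv (isUnit_intCast_zmod haj)
    refine Fintype.sum_equiv (Units.mulLeft hu.unit) _ _ fun t => ?_
    simp only [muMap, LinearMap.coe_mk, AddHom.coe_mk, Units.mulLeft_apply, IsUnit.unit_spec]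
    congr 1
    rw [pow_val_eq_zpow hzj (k := a * (((a : ZMod (m j))⁻¹ * t).val : ℤ)), zpow_mul, zpow_natCast]
    simp [← mul_assoc, ZMod.coe_int_mul_inv_eq_one haj]
  · rw [evalAt_apply_of_pow_ne_one hzj, evalAt_apply_of_pow_ne_one (hiff.not.2 hzj)]

variable {n : ℕ} [NeZero n] {ξ : K}

lemma algebraMap_sum_mul_eq (hξ : IsPrimitiveRoot ξ n) (hdvd : ∀ j, m j ∣ n)
    (c d : ∀ j, ZMod (m j) → F) :
    algebraMap F K (∑ j, ∑ t, c j t * d j t) =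
      ∑ z ∈ Polynomial.nthRootsFinset n (1 : K),
        ∑ j, (m j : K)⁻¹ * (evalAt F m z c j * evalAt F m z⁻¹ d j) := by
  rw [Finset.sum_comm, map_sum]
  refine Finset.sum_congr rfl fun j _ => ?_
  obtain ⟨k, hk⟩ := hdvd j
  have hη : IsPrimitiveRoot (ξ ^ k) (m j) := hξ.pow (NeZero.pos n) (by rw [hk, mul_comm])
  have hmj : (m j : K) ≠ 0 := (hη.neZero' (R := K)).out
  have hsub : Polynomial.nthRootsFinset (m j) (1 : K) ⊆ Polynomial.nthRootsFinset n (1 : K) := by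
    intro z hz
    rw [Polynomial.mem_nthRootsFinset (NeZero.pos _)] at hz ⊢
    rw [hk, pow_mul, hz, one_pow]
  rw [← Finset.mul_sum, ← Finset.sum_subset hsub, eq_inv_mul_iff_mul_eq₀ hmj]
  · calc (m j : K) * algebraMap F K (∑ t, c j t * d j t)
        = ∑ t, ∑ u, algebraMap F K (c j t) * algebraMap F K (d j u) *
            (if t = u then (m j : K) else 0) := by
          simp [Finset.mul_sum, mul_comm]
      _ = _ := by
          simp only [← sum_nthRootsFinset_pow_val_mul hη, Finset.mul_sum]
          rw [Finset.sum_congr rfl fun t _ => Finset.sum_comm, Finset.sum_comm]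
          refine Finset.sum_congr rfl fun z hz => ?_
          rw [Polynomial.mem_nthRootsFinset (NeZero.pos _)] at hz
          rw [evalAt_apply_of_pow_eq_one hz,
            evalAt_apply_of_pow_eq_one (by rw [inv_pow, hz, inv_one]), Finset.sum_mul_sum]
          refine Finset.sum_congr rfl fun t _ => Finset.sum_congr rfl fun u _ => ?_
          ring
  · intro z _ hz
    rw [Polynomial.mem_nthRootsFinset (NeZero.pos _)] at hz
    rw [evalAt_apply_of_pow_ne_one hz, zero_mul]

lemma eq_zero_of_forall_evalAt_eq_zero (hξ : IsPrimitiveRoot ξ n) (hdvd : ∀ j, m j ∣ n)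
    {c : ∀ j, ZMod (m j) → F} (hc : ∀ z : K, z ^ n = 1 → evalAt F m z c = 0) : c = 0 := by
  refine gqcForm_nondegenerate.2 c fun d => ?_
  apply (algebraMap F K).injective
  rw [gqcForm_apply, algebraMap_sum_mul_eq hξ hdvd, map_zero]
  refine Finset.sum_eq_zero fun z hz => ?_
  rw [Polynomial.mem_nthRootsFinset (NeZero.pos _)] at hz
  simp [hc z hz]

variable {C : Submodule F (∀ j, ZMod (m j) → F)}

lemma sum_evalAt_mul_evalAt_eq_zero (hξ : IsPrimitiveRoot ξ n) (hdvd : ∀ j, m j ∣ n)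
    (hC : IsGQC C) {c d : ∀ j, ZMod (m j) → F} (hc : c ∈ C) (hd : d ∈ gqcDual C) {z : K}
    (hz : z ^ n = 1) : ∑ j, (m j : K)⁻¹ * (evalAt F m z c j * evalAt F m z⁻¹ d j) = 0 := by
  have hshift (s : ℕ) : ∃ c' ∈ C, ∀ y : K, evalAt F m y c' = y ^ s • evalAt F m y c := by
    induction s with
    | zero => exact ⟨c, hc, fun y => by simp⟩
    | succ s ih =>
      obtain ⟨c', hc', h⟩ := ih
      exact ⟨_, hC c' hc', fun y => by rw [evalAt_shift, h, smul_smul, pow_succ']⟩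
  refine eq_zero_of_forall_sum_pow_mul_eq_zero
    (g := fun z : K => ∑ j, (m j : K)⁻¹ * (evalAt F m z c j * evalAt F m z⁻¹ d j))
    (fun s => ?_) ((Polynomial.mem_nthRootsFinset (NeZero.pos n) 1).2 hz)
  obtain ⟨c', hc', h⟩ := hshift s
  have hdc := congrArg (algebraMap F K) (hd c' hc')
  simp only [mul_comm (d _ _)] at hdc
  rw [algebraMap_sum_mul_eq hξ hdvd, map_zero] at hdc
  rw [← hdc]
  refine Finset.sum_congr rfl fun y _ => ?_
  rw [Finset.mul_sum]
  refine Finset.sum_congr rfl fun j _ => ?_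
  rw [h, Pi.smul_apply, smul_eq_mul]
  ring

end Evaluation

section Duality

variable {K : Type*} [Field K] [Algebra F K] {n : ℕ} [NeZero n] {ξ : K}
  {C : Submodule F (∀ j, ZMod (m j) → F)}

/-- Each evaluation of `C` at an `n`-th root of unity is zero or contains the standard basis
vectors of the active coordinates. -/
def ZeroOrFull (K : Type*) [Field K] [Algebra F K] (n : ℕ)
    (C : Submodule F (∀ j, ZMod (m j) → F)) : Prop :=
  ∀ z : K, z ^ n = 1 → (∀ c ∈ C, evalAt F m z c = 0) ∨
    ∀ j, z ^ m j = 1 → ∃ c ∈ C, evalAt F m z c = Pi.single j 1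

lemma evalAt_inv_eq_zero_of_mem_gqcDual (hξ : IsPrimitiveRoot ξ n) (hdvd : ∀ j, m j ∣ n)
    (hC : IsGQC C) (hfull : ZeroOrFull K n C) {z : K} (hz : z ^ n = 1)
    (hne : ¬ ∀ c ∈ C, evalAt F m z c = 0) {d : ∀ j, ZMod (m j) → F} (hd : d ∈ gqcDual C) :
    evalAt F m z⁻¹ d = 0 := by
  funext j
  by_cases hzj : z ^ m j = 1
  · obtain ⟨c, hc, hcj⟩ := (hfull z hz).resolve_left hne j hzj
    have hsum := sum_evalAt_mul_evalAt_eq_zero hξ hdvd hC hc hd hz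
    obtain ⟨k, hk⟩ := hdvd j
    have hmj : (m j : K) ≠ 0 :=
      ((hξ.pow (NeZero.pos n) (by rw [hk, mul_comm]) :
        IsPrimitiveRoot (ξ ^ k) (m j)).neZero' (R := K)).out
    rw [hcj, Finset.sum_eq_single j (fun i _ hij => by simp [hij]) (by simp)] at hsum
    simpa [hmj] using hsum
  · exact evalAt_apply_of_pow_ne_one (by simpa using hzj) d

lemma mem_of_forall_evalAt_eq_zero (hξ : IsPrimitiveRoot ξ n) (hdvd : ∀ j, m j ∣ n)
    (hC : IsGQC C) (hfull : ZeroOrFull K n C) {c : ∀ j, ZMod (m j) → F}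
    (hc : ∀ z : K, z ^ n = 1 → (∀ c' ∈ C, evalAt F m z c' = 0) → evalAt F m z c = 0) :
    c ∈ C := by
  rw [← gqcDual_gqcDual C]
  intro d hd
  apply (algebraMap F K).injective
  rw [algebraMap_sum_mul_eq hξ hdvd, map_zero]
  refine Finset.sum_eq_zero fun z hz => ?_
  rw [Polynomial.mem_nthRootsFinset (NeZero.pos _)] at hz
  by_cases h : ∀ c' ∈ C, evalAt F m z c' = 0
  · simp [hc z hz h]
  · simp [evalAt_inv_eq_zero_of_mem_gqcDual hξ hdvd hC hfull hz h hd]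

lemma evalAt_eq_zero_of_mem_gqcDual_map (hξ : IsPrimitiveRoot ξ n) (hdvd : ∀ j, m j ∣ n)
    (hC : IsGQC C) (hfull : ZeroOrFull K n C) {a : ℤ} (ha : IsCoprime a n) {z : K}
    (hz : z ^ n = 1) (hne : ¬ ∀ c ∈ C, evalAt F m (z ^ (-a)) c = 0)
    {d : ∀ j, ZMod (m j) → F} (hd : d ∈ gqcDual (C.map (muMap m a))) :
    evalAt F m z d = 0 := by
  have haj (j) : IsCoprime a (m j : ℤ) :=
    ha.of_isCoprime_of_dvd_right (Int.natCast_dvd_natCast.2 (hdvd j))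
  obtain ⟨d, rfl⟩ := (muMap_bijective haj).2 d
  have hd' : d ∈ gqcDual C := fun c hc => by
    rw [← sum_muMap_mul_muMap haj]
    exact hd _ (Submodule.mem_map_of_mem hc)
  rw [evalAt_muMap hz ha hdvd, ← inv_inv (z ^ a), ← zpow_neg]
  refine evalAt_inv_eq_zero_of_mem_gqcDual hξ hdvd hC hfull ?_ hne hd'
  rw [← zpow_natCast, ← zpow_mul, mul_comm, zpow_mul, zpow_natCast, hz, one_zpow]

lemma zpow_iff_of_zpow_imp {p : K → Prop} {b : ℤ} (hb : IsCoprime b n)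
    (h : ∀ z : K, z ^ n = 1 → p (z ^ b) → p z) {z : K} (hz : z ^ n = 1) :
    p (z ^ b) ↔ p z := by
  refine ⟨h z hz, fun hpz => ?_⟩
  have hiter (k : ℕ) : ∀ y : K, y ^ n = 1 → p (y ^ (b ^ k)) → p y := by
    induction k with
    | zero => simp
    | succ k ih =>
      intro y hy hp
      refine ih y hy (h _ ?_ (by rwa [← zpow_mul, ← pow_succ]))
      rw [← zpow_natCast, ← zpow_mul, mul_comm, zpow_mul, zpow_natCast, hy, one_zpow]
  refine hiter (n.totient - 1) _ ?_ ?_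
  · rw [← zpow_natCast, ← zpow_mul, mul_comm, zpow_mul, zpow_natCast, hz, one_zpow]
  · have hmod : b ^ n.totient ≡ 1 [ZMOD n] := by
      rw [← ZMod.intCast_eq_intCast_iff]
      have := congrArg Units.val (ZMod.pow_totient (ZMod.unitOfIsCoprime b hb))
      simpa only [Units.val_pow_eq_pow_val, ZMod.coe_unitOfIsCoprime, Units.val_one,
        Int.cast_pow, Int.cast_one] using this
    rwa [← zpow_mul, ← pow_succ', Nat.sub_add_cancel (Nat.totient_pos.2 (NeZero.pos n)),
      zpow_eq_zpow_of_modEq hz hmod (ne_zero_of_pow_eq_one hz), zpow_one]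

lemma inf_gqcDual_map_eq_bot_iff (hξ : IsPrimitiveRoot ξ n) (hdvd : ∀ j, m j ∣ n)
    (hC : IsGQC C) (hfull : ZeroOrFull K n C) {a : ℤ} (ha : IsCoprime a n) :
    C ⊓ gqcDual (C.map (muMap m a)) = ⊥ ↔
      ∀ z : K, z ^ n = 1 →
        ((∀ c ∈ C, evalAt F m (z ^ (-a)) c = 0) ↔ ∀ c ∈ C, evalAt F m z c = 0) := by
  constructor
  · intro h z hz
    suffices H : ∀ z : K, z ^ n = 1 → (¬ ∀ c ∈ C, evalAt F m (z ^ (-a)) c = 0) →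
        ¬ ∀ c ∈ C, evalAt F m z c = 0 from
      not_iff_not.1 (zpow_iff_of_zpow_imp (p := fun z => ¬ ∀ c ∈ C, evalAt F m z c = 0)
        ha.neg_left H hz)
    intro z hz hne hzero
    apply hne
    intro c _
    have haj (j) : IsCoprime a (m j : ℤ) :=
      ha.of_isCoprime_of_dvd_right (Int.natCast_dvd_natCast.2 (hdvd j))
    have htop := sup_gqcDual_eq_top
      (Submodule.equivMapOfInjective _ (muMap_bijective haj).1 C).finrank_eq.symm h
    rw [← evalAt_muMap hz ha.neg_left hdvd]
    obtain ⟨x, hx, y, hy, hxy⟩ := Submodule.mem_sup.1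
      (htop ▸ Submodule.mem_top : muMap m (-a) c ∈ C ⊔ gqcDual (C.map (muMap m a)))
    rw [← hxy, map_add, hzero x hx,
      evalAt_eq_zero_of_mem_gqcDual_map hξ hdvd hC hfull ha hz hne hy, add_zero]
  · intro h
    rw [Submodule.eq_bot_iff]
    rintro d ⟨hdC, hd⟩
    refine eq_zero_of_forall_evalAt_eq_zero hξ hdvd fun z hz => ?_
    by_cases hzero : ∀ c ∈ C, evalAt F m z c = 0
    · exact hzero d hdC
    · exact evalAt_eq_zero_of_mem_gqcDual_map hξ hdvd hC hfull ha hz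
        (mt (h z hz).1 hzero) hd

lemma map_muMap_eq_iff (hξ : IsPrimitiveRoot ξ n) (hdvd : ∀ j, m j ∣ n)
    (hC : IsGQC C) (hfull : ZeroOrFull K n C) {b : ℤ} (hb : IsCoprime b n) :
    C.map (muMap m b) = C ↔
      ∀ z : K, z ^ n = 1 →
        ((∀ c ∈ C, evalAt F m (z ^ b) c = 0) ↔ ∀ c ∈ C, evalAt F m z c = 0) := by
  constructor
  · intro h z hz
    conv_rhs => rw [← h]
    simp [evalAt_muMap hz hb hdvd]
  · intro h
    have hbj (j) : IsCoprime b (m j : ℤ) :=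
      hb.of_isCoprime_of_dvd_right (Int.natCast_dvd_natCast.2 (hdvd j))
    refine Submodule.eq_of_le_of_finrank_eq ?_
      (Submodule.equivMapOfInjective _ (muMap_bijective hbj).1 C).finrank_eq.symm
    rintro _ ⟨c, hc, rfl⟩
    refine mem_of_forall_evalAt_eq_zero hξ hdvd hC hfull fun z hz hzero => ?_
    rw [evalAt_muMap hz hb hdvd]
    exact (h z hz).2 hzero c hc

lemma zeroOrFull_of_constituent (hξ : IsPrimitiveRoot ξ n)
    (hfull : ∀ i < n, constituent ξ C i = {0} ∨ constituent ξ C i = Vset m F ξ i) :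
    ZeroOrFull K n C := by
  intro z hz
  obtain ⟨i, hi, rfl⟩ := hξ.eq_pow_of_pow_eq_one hz
  refine (hfull i hi).imp (fun h c hc => ?_) fun h j hj => ?_
  · rw [constituent_eq_range_evalAt] at h
    exact h.subset ⟨c, hc, rfl⟩
  · rw [constituent_eq_range_evalAt] at h
    refine h.superset ⟨fun k => ?_, fun k hk => ?_⟩
    · obtain rfl | hkj := eq_or_ne k j
      · simp [one_mem]
      · simp [hkj, zero_mem]
    · refine Pi.single_eq_of_ne ?_ _
      rintro rfl
      exact hk (by rw [pow_mul, hj])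

lemma constituent_eq_singleton_zero_iff (i : ℕ) :
    constituent ξ C i = {0} ↔ ∀ c ∈ C, evalAt F m (ξ ^ i) c = 0 := by
  rw [constituent_eq_range_evalAt]
  refine ⟨fun h c hc => h.subset ⟨c, hc, rfl⟩, fun h => ?_⟩
  ext v
  constructor
  · rintro ⟨c, hc, rfl⟩
    exact h c hc
  · rintro rfl
    exact ⟨0, C.zero_mem, map_zero _⟩

end Duality

end Code

lemma Set.BijOn.image_eq_iff_forall_mem_iff {α : Type*} {A B : Set α} {f : α → α}
    (hf : Set.BijOn f A A) (hB : B ⊆ A) : f '' B = B ↔ ∀ i ∈ A, (f i ∈ B ↔ i ∈ B) := by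
  constructor
  · intro h i hi
    conv_lhs => rw [← h]
    exact hf.injOn.mem_image_iff hB hi
  · intro h
    ext x
    constructor
    · rintro ⟨i, hi, rfl⟩
      exact (h i (hB hi)).2 hi
    · intro hx
      obtain ⟨i, hi, rfl⟩ := hf.surjOn (hB hx)
      exact ⟨i, (h i hi).1 hx, rfl⟩

/-- Let `a` be an integer with `gcd(a,m) = 1` and `C` a `q`-ary GQC code of block lengths
`(m_1, …, m_l)` all of whose constituents satisfy `C_i = {0}` or `C_i = V_i`.  Let
`T = {i ∈ Z_m : C_i = {0}}` and `S = Z_m \ T`.  Then the following are equivalent: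
(1) `C` is `μ_a`-LCD;  (2) `S = -aS`;  (3) `T = -aT`;  (4) `μ_{-a}(C) = C`. -/
theorem gqc_zero_or_full_lcd_iff
    {F : Type*} [Field F] [Fintype F] {l : ℕ} (mlen : Fin l → ℕ) [∀ j, NeZero (mlen j)]
    (hcop : ∀ j, Nat.Coprime (mlen j) (Fintype.card F))
    (m : ℕ) [NeZero m] (hm : m = Finset.univ.lcm mlen)
    {K : Type*} [Field K] [Algebra F K] [IsAlgClosed K] [Algebra.IsAlgebraic F K]
    (ξ : K) (hξ : IsPrimitiveRoot ξ m)
    (a : ℤ) (ha : Int.gcd a m = 1)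
    (negai : ℕ → ℕ) (hnegai : ∀ i : ℕ, (negai i : ℤ) = (-a * (i : ℤ)) % (m : ℤ))
    (C : Submodule F (∀ j, ZMod (mlen j) → F)) (hC : IsGQC C)
    (hfull : ∀ i < m, constituent ξ C i = {0} ∨ constituent ξ C i = Vset mlen F ξ i)
    (T S : Set ℕ) (hT : T = {i | i < m ∧ constituent ξ C i = {0}})
    (hS : S = {i | i < m} \ T) :
    ((C ⊓ gqcDual (C.map (muMap mlen a)) = ⊥ ↔ negai '' S = S) ∧
     (C ⊓ gqcDual (C.map (muMap mlen a)) = ⊥ ↔ negai '' T = T) ∧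
     (C ⊓ gqcDual (C.map (muMap mlen a)) = ⊥ ↔ C.map (muMap mlen (-a)) = C)) := by
  have hdvd (j) : mlen j ∣ m := hm ▸ Finset.dvd_lcm (Finset.mem_univ j)
  have hac : IsCoprime a m := Int.isCoprime_iff_gcd_eq_one.2 ha
  have hZF := zeroOrFull_of_constituent hξ hfull
  have hξm : ξ ^ m = 1 := hξ.pow_eq_one
  have hξ0 := ne_zero_of_pow_eq_one hξm
  have hlt (i) : negai i < m := by
    have := Int.emod_lt_of_pos (-a * (i : ℤ)) (Int.natCast_pos.2 (NeZero.pos m))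
    rw [← hnegai] at this
    exact_mod_cast this
  have hpow (i) : ξ ^ negai i = (ξ ^ i) ^ (-a) := by
    rw [← zpow_natCast, ← zpow_natCast, ← zpow_mul, hnegai, mul_comm (i : ℤ)]
    exact zpow_eq_zpow_of_modEq hξm (Int.mod_modEq _ _) hξ0
  have hbij : Set.BijOn negai {i | i < m} {i | i < m} := by
    have hinj : Set.InjOn negai {i | i < m} := by
      intro i hi k hk hik
      have h : -a * (i : ℤ) ≡ -a * (k : ℤ) [ZMOD m] := by
        rw [Int.ModEq, ← hnegai, ← hnegai, hik]
      have hcancel := Int.ModEq.cancel_left_div_gcd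
        (Int.natCast_pos.2 (NeZero.pos m)) h
      rw [Int.gcd_comm, Int.neg_gcd, ha, Nat.cast_one, Int.ediv_one,
        Int.natCast_modEq_iff] at hcancel
      exact hcancel.eq_of_lt_of_lt hi hk
    refine ⟨fun i _ => hlt i, hinj, ?_⟩
    have hsurj := Finset.surjOn_of_injOn_of_card_le (s := Finset.range m) (t := Finset.range m)
      negai (fun i _ => by simpa using hlt i) (by rw [Finset.coe_range]; exact hinj) le_rfl
    rw [Finset.coe_range] at hsurj
    exact hsurj
  have hTiff : (∀ z : K, z ^ m = 1 →
      ((∀ c ∈ C, evalAt F mlen (z ^ (-a)) c = 0) ↔ ∀ c ∈ C, evalAt F mlen z c = 0)) ↔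
      ∀ i ∈ {i | i < m}, (negai i ∈ T ↔ i ∈ T) := by
    have hmem (i) (hi : i < m) : i ∈ T ↔ ∀ c ∈ C, evalAt F mlen (ξ ^ i) c = 0 := by
      rw [hT, ← constituent_eq_singleton_zero_iff]
      exact and_iff_right hi
    constructor
    · intro h i hi
      rw [hmem i hi, hmem _ (hlt i), hpow]
      exact h _ (by rw [← pow_mul, mul_comm, pow_mul, hξm, one_pow])
    · intro h z hz
      obtain ⟨i, hi, rfl⟩ := hξ.eq_pow_of_pow_eq_one hz
      rw [← hpow, ← hmem i hi, ← hmem _ (hlt i)]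
      exact h i hi
  have hSiff : (∀ i ∈ {i | i < m}, (negai i ∈ T ↔ i ∈ T)) ↔
      ∀ i ∈ {i | i < m}, (negai i ∈ S ↔ i ∈ S) := by
    refine forall₂_congr fun i hi => ?_
    rw [hS, Set.mem_sdiff, Set.mem_sdiff, and_iff_right hi,
      and_iff_right (show negai i ∈ {i | i < m} from hlt i), not_iff_not]
  rw [inf_gqcDual_map_eq_bot_iff hξ hdvd hC hZF hac,
    map_muMap_eq_iff hξ hdvd hC hZF hac.neg_left,
    hbij.image_eq_iff_forall_mem_iff (hS ▸ Set.sdiff_subset),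
    hbij.image_eq_iff_forall_mem_iff (hT ▸ fun i hi => hi.1), ← hSiff, hTiff]
  exact ⟨Iff.rfl, Iff.rfl, Iff.rfl⟩
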